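/- arXiv:1404.3850 — 3 statements merged into one kernel-verified Lean document; each statement's English description precedes it below -/
import Mathlib

section
/- Let α > 1 be fixed. Then lim_{p → α⁺} (p − α) · (p/(α−1))^p · L_α(p) = 1; that is, L_α(p) is asymptotically equivalent to ((α−1)^p / p^p) · (p−α)^{−1} as p → α from above. -/
open MeasureTheory Real Set Filter Topology
open scoped ENNReal

/-- `L_α(p) = ∫_0^1 |1 − r^{(α−1)/p}|^p / (1−r)^{1+α} dr`. -/
noncomputable def Lfun (α p : ℝ) : ℝ :=
  ∫ r in Set.Ioo (0 : ℝ) 1, |1 - r ^ ((α - 1) / p)| ^ p / (1 - r) ^ (1 + α)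

lemma integrableOn_one_sub_rpow {e : ℝ} (he : -1 < e) :
    IntegrableOn (fun r : ℝ => (1 - r) ^ e) (Ioo 0 1) := by
  have h := (intervalIntegral.intervalIntegrable_rpow' (a := 0) (b := 1) he).comp_sub_left 1
  simp only [sub_zero, sub_self] at h
  exact (intervalIntegrable_iff_integrableOn_Ioo_of_le zero_le_one).1 h.symm

lemma setIntegral_one_sub_rpow {e : ℝ} (he : -1 < e) :
    ∫ r in Ioo (0 : ℝ) 1, (1 - r) ^ e = 1 / (e + 1) := by
  rw [← integral_Ioc_eq_integral_Ioo, ← intervalIntegral.integral_of_le zero_le_one,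
    intervalIntegral.integral_comp_sub_left (fun x : ℝ => x ^ e) 1, sub_self, sub_zero,
    integral_rpow (Or.inl he), one_rpow, zero_rpow (by linarith), sub_zero]

lemma mul_one_sub_le_one_sub_rpow {θ r : ℝ} (h0 : 0 ≤ θ) (h1 : θ ≤ 1) (hr : 0 ≤ r) :
    θ * (1 - r) ≤ 1 - r ^ θ := by
  have h := rpow_one_add_le_one_add_mul_self (s := r - 1) (by linarith) h0 h1
  rw [show 1 + (r - 1) = r by ring] at h
  linarith

lemma one_sub_rpow_le {θ r : ℝ} (h0 : 0 ≤ θ) (h1 : θ ≤ 1) (hr : 0 < r) (hr1 : r ≤ 1) :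
    1 - r ^ θ ≤ (1 - r) * (θ + (1 - θ) * (1 - r)) := by
  have h := mul_one_sub_le_one_sub_rpow (θ := 1 - θ) (by linarith) (by linarith) hr.le
  have hmul : r ^ θ * r ^ (1 - θ) = r := by
    rw [← rpow_add hr, add_sub_cancel, rpow_one]
  have hpos : 0 < r ^ θ := rpow_pos_of_pos hr θ
  have hs : 0 ≤ (1 - θ) * (1 - r) := mul_nonneg (by linarith) (by linarith)
  have key : r * (1 + (1 - θ) * (1 - r)) ≤ r ^ θ := by
    calc r * (1 + (1 - θ) * (1 - r))
        = r ^ θ * (r ^ (1 - θ) * (1 + (1 - θ) * (1 - r))) := by rw [← mul_assoc, hmul]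
      _ ≤ r ^ θ * 1 := by
          gcongr
          nlinarith
      _ = r ^ θ := mul_one _
  linarith

lemma one_add_mul_rpow_le {A u p : ℝ} (hA : 0 ≤ A) (hu : 0 ≤ u) (hu1 : u ≤ 1) (hp : 1 ≤ p) :
    (1 + (A - 1) * u) ^ p ≤ 1 + (A ^ p - 1) * u := by
  have h := (convexOn_rpow hp).2 (mem_Ici.2 zero_le_one) (mem_Ici.2 hA)
    (sub_nonneg.2 hu1) hu (sub_add_cancel 1 u)
  simp only [smul_eq_mul, one_rpow] at h
  rw [show 1 + (A - 1) * u = (1 - u) * 1 + u * A by ring]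
  linarith

lemma Lfun_integrand_bounds {α p r : ℝ} (hα : 1 < α) (hp : α < p) (hr : r ∈ Ioo (0 : ℝ) 1) :
    (1 - r) ^ (p - α - 1) ≤
        (p / (α - 1)) ^ p * (|1 - r ^ ((α - 1) / p)| ^ p / (1 - r) ^ (1 + α)) ∧
      (p / (α - 1)) ^ p * (|1 - r ^ ((α - 1) / p)| ^ p / (1 - r) ^ (1 + α)) ≤
        (1 - r) ^ (p - α - 1) + ((p / (α - 1)) ^ p - 1) * (1 - r) ^ (p - α) := by
  obtain ⟨hr0, hr1⟩ := hr
  have hα' : 0 < α - 1 := by linarith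
  have hp0 : 0 < p := by linarith
  set A := p / (α - 1) with hA
  set θ := (α - 1) / p with hθ
  have hA0 : 0 < A := by positivity
  have hAθ : A * θ = 1 := by rw [hA, hθ]; field_simp
  have hθ0 : 0 < θ := by positivity
  have hθ1 : θ ≤ 1 := by rw [hθ, div_le_one hp0]; linarith
  set u := 1 - r with hu
  have hu0 : 0 < u := by linarith
  have hlow := mul_one_sub_le_one_sub_rpow hθ0.le hθ1 hr0.le
  have hupp := one_sub_rpow_le hθ0.le hθ1 hr0 hr1.le
  rw [← hu] at hlow hupp
  have hd0 : 0 ≤ 1 - r ^ θ := le_trans (by positivity) hlow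
  set w := A * (1 - r ^ θ) / u with hw
  have hw1 : 1 ≤ w := by
    rw [hw, le_div_iff₀ hu0]
    nlinarith
  have hw2 : w ≤ 1 + (A - 1) * u := by
    rw [hw, div_le_iff₀ hu0]
    calc A * (1 - r ^ θ) ≤ A * (u * (θ + (1 - θ) * u)) := by gcongr
      _ = (A * θ + (A - A * θ) * u) * u := by ring
      _ = (1 + (A - 1) * u) * u := by rw [hAθ]
  have hpow : u ^ p / u ^ (1 + α) = u ^ (p - α - 1) := by
    rw [← rpow_sub hu0]; congr 1; ring
  have heq : A ^ p * (|1 - r ^ θ| ^ p / u ^ (1 + α)) = w ^ p * u ^ (p - α - 1) := by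
    rw [abs_of_nonneg hd0, ← hpow, ← mul_div_assoc, ← mul_div_assoc, ← mul_rpow hA0.le hd0,
      ← mul_rpow (by linarith) hu0.le, hw, div_mul_cancel₀ _ hu0.ne']
  have hmul : u ^ (p - α) = u * u ^ (p - α - 1) := by
    rw [← rpow_one_add' hu0.le (by linarith)]; congr 1; ring
  have hwp : w ^ p ≤ 1 + (A ^ p - 1) * u :=
    (rpow_le_rpow (by linarith) hw2 hp0.le).trans
      (one_add_mul_rpow_le hA0.le hu0.le (by linarith) (by linarith))
  have hpos : 0 ≤ u ^ (p - α - 1) := by positivity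
  rw [heq]
  constructor
  · exact le_mul_of_one_le_left hpos (one_le_rpow hw1 hp0.le)
  · rw [hmul]
    nlinarith [mul_le_mul_of_nonneg_right hwp hpos]

lemma Lfun_bounds {α p : ℝ} (hα : 1 < α) (hp : α < p) :
    1 ≤ (p - α) * (p / (α - 1)) ^ p * Lfun α p ∧
      (p - α) * (p / (α - 1)) ^ p * Lfun α p ≤
        1 + ((p / (α - 1)) ^ p - 1) * ((p - α) / (p - α + 1)) := by
  have hpα : 0 < p - α := by linarith
  have hi1 := integrableOn_one_sub_rpow (e := p - α - 1) (by linarith)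
  have hi2 := (integrableOn_one_sub_rpow (e := p - α) (by linarith)).const_mul
    ((p / (α - 1)) ^ p - 1)
  have hsum := hi1.add hi2
  have hF : IntegrableOn (fun r : ℝ =>
      (p / (α - 1)) ^ p * (|1 - r ^ ((α - 1) / p)| ^ p / (1 - r) ^ (1 + α))) (Ioo 0 1) := by
    refine Integrable.mono' hsum (Measurable.aestronglyMeasurable (by fun_prop)) ?_
    filter_upwards [ae_restrict_mem measurableSet_Ioo] with r hr
    have hb := Lfun_integrand_bounds hα hp hr
    have h0 : 0 ≤ (1 - r) ^ (p - α - 1) := rpow_nonneg (by linarith [hr.2]) _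
    rw [norm_of_nonneg (h0.trans hb.1)]
    exact hb.2
  have h1 := setIntegral_mono_on hi1 hF measurableSet_Ioo
    fun r hr => (Lfun_integrand_bounds hα hp hr).1
  have h2 := setIntegral_mono_on hF hsum measurableSet_Ioo
    fun r hr => (Lfun_integrand_bounds hα hp hr).2
  simp only [Pi.add_apply] at h2
  rw [integral_add hi1 hi2, integral_const_mul, integral_const_mul,
    setIntegral_one_sub_rpow (by linarith), setIntegral_one_sub_rpow (by linarith)] at h2
  rw [integral_const_mul, setIntegral_one_sub_rpow (by linarith)] at h1
  rw [sub_add_cancel] at h1 h2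
  rw [mul_assoc, Lfun]
  constructor
  · calc (1 : ℝ) = (p - α) * (1 / (p - α)) := by field_simp
      _ ≤ _ := by gcongr
  · refine (mul_le_mul_of_nonneg_left h2 hpα.le).trans_eq ?_
    field_simp

/-- `L_α(p) ∼ ((α−1)^p/p^p)·(p−α)^{−1}` as `p → α⁺`, i.e.
`(p−α)·(p/(α−1))^p·L_α(p) → 1` as `p → α` from above. -/
theorem Lfun_asymptotic_at_alpha (α : ℝ) (hα : 1 < α) :
    Tendsto (fun p : ℝ => (p - α) * (p / (α - 1)) ^ p * Lfun α p)
      (nhdsWithin α (Set.Ioi α)) (nhds 1) := by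
  have hA : α / (α - 1) ≠ 0 := (div_pos (by linarith) (by linarith)).ne'
  have hc : ContinuousAt (fun p : ℝ =>
      1 + ((p / (α - 1)) ^ p - 1) * ((p - α) / (p - α + 1))) α := by
    have h1 : ContinuousAt (fun p : ℝ => (p / (α - 1)) ^ p) α :=
      (continuousAt_id.div_const _).rpow continuousAt_id (Or.inl hA)
    have h2 : ContinuousAt (fun p : ℝ => (p - α) / (p - α + 1)) α :=
      ContinuousAt.div (by fun_prop) (by fun_prop) (by simp)
    exact continuousAt_const.add ((h1.sub continuousAt_const).mul h2)
  have hupp := hc.tendsto.mono_left (nhdsWithin_le_nhds (s := Ioi α))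
  simp only [sub_self, zero_div, mul_zero, add_zero] at hupp
  refine tendsto_of_tendsto_of_tendsto_of_le_of_le' tendsto_const_nhds hupp ?_ ?_
  · filter_upwards [self_mem_nhdsWithin] with p hp using (Lfun_bounds hα hp).1
  · filter_upwards [self_mem_nhdsWithin] with p hp using (Lfun_bounds hα hp).2
end

section
/- Let α > 1. There exists a constant C = C(α) ∈ (0,1) such that for every p > α, L_α(p) ≥ C^p · ((α−1)^p / p^p) · [ Γ(p+1) + 1/(p−α) ]. -/
open MeasureTheory Real Set Filter Topology
open scoped ENNReal

theorem integrableOn_one_sub_rpow_Ioo {a : ℝ} (ha : -1 < a) :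
    IntegrableOn (fun r : ℝ => (1 - r) ^ a) (Ioo 0 1) := by
  have h : IntervalIntegrable (fun x : ℝ => x ^ a) volume 0 1 :=
    intervalIntegral.intervalIntegrable_rpow' ha
  have h' := (h.comp_sub_left 1).symm
  simp only [sub_self, sub_zero] at h'
  exact ((intervalIntegrable_iff_integrableOn_Ioo_of_le zero_le_one).1 h')

theorem integral_one_sub_rpow_Ioo {a : ℝ} (ha : -1 < a) :
    ∫ r in Ioo (0 : ℝ) 1, (1 - r) ^ a = 1 / (a + 1) := by
  rw [← integral_Ioc_eq_integral_Ioo, ← intervalIntegral.integral_of_le zero_le_one,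
    intervalIntegral.integral_comp_sub_left (fun x : ℝ => x ^ a), integral_rpow (Or.inl ha)]
  have : a + 1 ≠ 0 := by linarith
  simp [Real.zero_rpow this]

theorem image_exp_neg_Ioi : (fun t : ℝ => Real.exp (-t)) '' Ioi 0 = Ioo 0 1 := by
  ext r
  constructor
  · rintro ⟨t, ht, rfl⟩
    exact ⟨Real.exp_pos _, by simpa using ht⟩
  · rintro ⟨h0, h1⟩
    exact ⟨-Real.log r, by simpa using Real.log_neg h0 h1, by simp [Real.exp_log h0]⟩

theorem integral_rpow_mul_neg_log_rpow_Ioo {s p : ℝ} (hs : -1 < s) (hp : -1 < p) :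
    ∫ r in Ioo (0 : ℝ) 1, r ^ s * (-Real.log r) ^ p =
      (1 / (s + 1)) ^ (p + 1) * Real.Gamma (p + 1) := by
  have hd : ∀ t ∈ Ioi (0 : ℝ),
      HasDerivWithinAt (fun t : ℝ => Real.exp (-t)) (-Real.exp (-t)) (Ioi 0) t := by
    intro t _
    simpa using ((hasDerivAt_id t).neg.exp).hasDerivWithinAt
  have hinj : InjOn (fun t : ℝ => Real.exp (-t)) (Ioi 0) := by
    intro x _ y _ hxy
    simpa using hxy
  rw [← image_exp_neg_Ioi, integral_image_eq_integral_abs_deriv_smul measurableSet_Ioi hd hinj,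
    ← Real.integral_rpow_mul_exp_neg_mul_Ioi (by linarith) (by linarith)]
  refine setIntegral_congr_fun measurableSet_Ioi fun t _ => ?_
  simp only [abs_neg, Real.abs_exp, Real.log_exp, neg_neg, smul_eq_mul, add_sub_cancel_right]
  rw [← Real.exp_mul, ← mul_assoc, ← Real.exp_add, mul_comm]
  ring_nf

theorem one_sub_rpow_nonneg {b r : ℝ} (hb : 0 ≤ b) (hr : r ∈ Ioo (0 : ℝ) 1) : 0 ≤ 1 - r ^ b :=
  sub_nonneg.2 (Real.rpow_le_one hr.1.le hr.2.le hb)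

theorem mul_one_sub_le_one_sub_rpow_s9 {b r : ℝ} (hb : 0 ≤ b) (hb1 : b ≤ 1)
    (hr : r ∈ Ioo (0 : ℝ) 1) : b * (1 - r) ≤ 1 - r ^ b := by
  have := rpow_one_add_le_one_add_mul_self (s := r - 1) (by linarith [hr.1]) hb hb1
  rw [add_sub_cancel] at this
  linarith

theorem mul_neg_log_mul_rpow_le_one_sub_rpow {b r : ℝ} (hr : 0 < r) :
    b * (-Real.log r) * r ^ b ≤ 1 - r ^ b := by
  rw [Real.rpow_def_of_pos hr]
  have h := Real.add_one_le_exp (-(Real.log r * b))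
  have h' := mul_le_mul_of_nonneg_right h (Real.exp_pos (Real.log r * b)).le
  rw [← Real.exp_add, neg_add_cancel, Real.exp_zero] at h'
  linarith

section LowerEstimate

variable {α p : ℝ}

theorem integrableOn_Lfun_integrand (hα : 1 < α) (hp : α < p) :
    IntegrableOn (fun r : ℝ => |1 - r ^ ((α - 1) / p)| ^ p / (1 - r) ^ (1 + α)) (Ioo 0 1) := by
  have hp0 : 0 < p := by linarith
  refine Integrable.mono' (integrableOn_one_sub_rpow_Ioo (a := p - (1 + α)) (by linarith))
    (Measurable.aestronglyMeasurable (by fun_prop)) ?_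
  refine (ae_restrict_iff' measurableSet_Ioo).2 (Eventually.of_forall fun r hr => ?_)
  have h1r : 0 < 1 - r := sub_pos.2 hr.2
  rw [Real.norm_of_nonneg (by positivity), Real.rpow_sub h1r]
  have hb : 0 ≤ (α - 1) / p := div_nonneg (by linarith) hp0.le
  have hb1 : (α - 1) / p ≤ 1 := (div_le_one hp0).2 (by linarith)
  rw [abs_of_nonneg (one_sub_rpow_nonneg hb hr)]
  gcongr
  · exact one_sub_rpow_nonneg hb hr
  · simpa using Real.rpow_le_rpow_of_exponent_ge hr.1 hr.2.le hb1

theorem setIntegral_le_Lfun (hα : 1 < α) (hp : α < p) {f : ℝ → ℝ}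
    (hf0 : ∀ r ∈ Ioo (0 : ℝ) 1, 0 ≤ f r)
    (hf : ∀ r ∈ Ioo (0 : ℝ) 1, f r ≤ (1 - r ^ ((α - 1) / p)) ^ p / (1 - r) ^ (1 + α)) :
    ∫ r in Ioo (0 : ℝ) 1, f r ≤ Lfun α p := by
  refine integral_mono_of_nonneg ((ae_restrict_iff' measurableSet_Ioo).2
    (Eventually.of_forall hf0)) (integrableOn_Lfun_integrand hα hp)
    ((ae_restrict_iff' measurableSet_Ioo).2 (Eventually.of_forall fun r hr => ?_))
  have hb : 0 ≤ (α - 1) / p := div_nonneg (by linarith) (by linarith)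
  simpa only [abs_of_nonneg (one_sub_rpow_nonneg hb hr)] using hf r hr

theorem rpow_div_sub_le_Lfun (hα : 1 < α) (hp : α < p) :
    ((α - 1) / p) ^ p * (1 / (p - α)) ≤ Lfun α p := by
  have hp0 : 0 < p := by linarith
  have hb : 0 ≤ (α - 1) / p := div_nonneg (by linarith) hp0.le
  have hb1 : (α - 1) / p ≤ 1 := (div_le_one hp0).2 (by linarith)
  have h := integral_one_sub_rpow_Ioo (a := p - (1 + α)) (by linarith)
  rw [show p - (1 + α) + 1 = p - α by ring] at h
  rw [← h, ← integral_const_mul]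
  refine setIntegral_le_Lfun hα hp (fun r hr => ?_) fun r hr => ?_
  · have h1r : 0 < 1 - r := sub_pos.2 hr.2
    positivity
  · have h1r : 0 < 1 - r := sub_pos.2 hr.2
    rw [Real.rpow_sub h1r, ← mul_div_assoc, ← Real.mul_rpow hb h1r.le]
    gcongr
    exact mul_one_sub_le_one_sub_rpow_s9 hb hb1 hr

theorem rpow_mul_Gamma_le_Lfun (hα : 1 < α) (hp : α < p) :
    ((α - 1) / p) ^ p * ((1 / α) ^ (p + 1) * Real.Gamma (p + 1)) ≤ Lfun α p := by
  have hp0 : 0 < p := by linarith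
  have hb : 0 ≤ (α - 1) / p := div_nonneg (by linarith) hp0.le
  have h := integral_rpow_mul_neg_log_rpow_Ioo (s := α - 1) (p := p) (by linarith) (by linarith)
  rw [sub_add_cancel] at h
  rw [← h, ← integral_const_mul]
  refine setIntegral_le_Lfun hα hp (fun r hr => ?_) fun r hr => ?_
  · have hl : 0 < -Real.log r := neg_pos.2 (Real.log_neg hr.1 hr.2)
    have := hr.1
    positivity
  · have hl : 0 < -Real.log r := neg_pos.2 (Real.log_neg hr.1 hr.2)
    have h0 := hr.1
    have h1r : 0 < 1 - r := sub_pos.2 hr.2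
    have hs : r ^ (α - 1) = (r ^ ((α - 1) / p)) ^ p := by
      rw [← Real.rpow_mul h0.le, div_mul_cancel₀ _ hp0.ne']
    calc ((α - 1) / p) ^ p * (r ^ (α - 1) * (-Real.log r) ^ p)
        = ((α - 1) / p * (-Real.log r) * r ^ ((α - 1) / p)) ^ p := by
          rw [hs, Real.mul_rpow (by positivity) (by positivity), Real.mul_rpow hb hl.le]
          ring
      _ ≤ (1 - r ^ ((α - 1) / p)) ^ p := by
          gcongr
          exact mul_neg_log_mul_rpow_le_one_sub_rpow h0
      _ ≤ (1 - r ^ ((α - 1) / p)) ^ p / (1 - r) ^ (1 + α) := by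
          refine le_div_self (Real.rpow_nonneg (one_sub_rpow_nonneg hb hr) _) (by positivity) ?_
          exact Real.rpow_le_one h1r.le (by linarith) (by linarith)

end LowerEstimate

/-- the non-asymptotical lower bound: there is `C = C(α) ∈ (0,1)` with
`L_α(p) ≥ C^p·((α−1)^p/p^p)·[Γ(p+1) + 1/(p−α)]` for all `p > α`. -/
theorem Lfun_lower_estimate (α : ℝ) (hα : 1 < α) :
    ∃ C : ℝ, 0 < C ∧ C < 1 ∧ ∀ p : ℝ, α < p →
      C ^ p * ((α - 1) ^ p / p ^ p) * (Real.Gamma (p + 1) + 1 / (p - α)) ≤ Lfun α p := by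
  have hα0 : 0 < 1 / α := by positivity
  have hα1 : 1 / α ≤ 1 := (div_le_one (by linarith)).2 hα.le
  refine ⟨(1 / 2) * (1 / α) ^ (2 : ℝ), by positivity, ?_, fun p hp => ?_⟩
  · have := Real.rpow_le_one hα0.le hα1 zero_le_two
    linarith
  have hp0 : 0 < p := by linarith
  have hC : ((1 / 2) * (1 / α) ^ (2 : ℝ)) ^ p ≤ 1 / 2 * (1 / α) ^ (p + 1) := by
    rw [Real.mul_rpow (by norm_num) (by positivity), ← Real.rpow_mul hα0.le]
    gcongr ?_ * ?_
    · simpa using Real.rpow_le_rpow_of_exponent_ge (x := 1 / 2) (by norm_num) (by norm_num)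
        (show (1 : ℝ) ≤ p by linarith)
    · exact Real.rpow_le_rpow_of_exponent_ge hα0 hα1 (by linarith)
  have hG : 0 < Real.Gamma (p + 1) := Real.Gamma_pos_of_pos (by linarith)
  have hq : 0 < 1 / (p - α) := one_div_pos.2 (sub_pos.2 hp)
  have hB : 0 ≤ ((α - 1) / p) ^ p := Real.rpow_nonneg (div_nonneg (by linarith) hp0.le) _
  rw [← Real.div_rpow (by linarith) hp0.le]
  calc ((1 / 2) * (1 / α) ^ (2 : ℝ)) ^ p * ((α - 1) / p) ^ p * (Real.Gamma (p + 1) + 1 / (p - α))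
      ≤ 1 / 2 * (1 / α) ^ (p + 1) * ((α - 1) / p) ^ p * (Real.Gamma (p + 1) + 1 / (p - α)) := by
        gcongr
    _ = 1 / 2 * (((α - 1) / p) ^ p * ((1 / α) ^ (p + 1) * Real.Gamma (p + 1))) +
        1 / 2 * ((1 / α) ^ (p + 1) * (((α - 1) / p) ^ p * (1 / (p - α)))) := by ring
    _ ≤ 1 / 2 * Lfun α p + 1 / 2 * Lfun α p := by
        gcongr
        · exact rpow_mul_Gamma_le_Lfun hα hp
        · refine (mul_le_of_le_one_left (by positivity) ?_).trans (rpow_div_sub_le_Lfun hα hp)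
          exact Real.rpow_le_one hα0.le hα1 (by linarith)
    _ = Lfun α p := by ring
end

section
/- Let n be a positive integer, s ∈ (0,1), p ≥ 1. For every Lebesgue measurable set E ⊂ ℝ^n with 0 < |E| < ∞ and every x ∈ E, one has ∫_{ℝ^n ∖ E} |x−y|^{−n−sp} dy ≥ (sp)^{−1} · ω_n^{1+sp/n} · n^{−1−sp/n} · |E|^{−sp/n}, where |E| denotes the Lebesgue measure of E. Consequently, the constant Z(n,s,p) := inf over measurable sets E with 0 < |E| < ∞ and points x ∈ E of |E|^{sp/n} ∫_{ℝ^n∖E} |x−y|^{−n−sp} dy satisfies Z(n,s,p) ≥ (sp)^{−1} ω_n^{1+sp/n} n^{−1−sp/n}. -/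
open MeasureTheory Real Set Filter Topology
open scoped ENNReal

/-- `ω_n = 2π^{n/2}/Γ(n/2)`, the surface area of the unit sphere in `ℝⁿ`. -/
noncomputable def omegaN (n : ℕ) : ℝ :=
  2 * Real.pi ^ ((n : ℝ) / 2) / Real.Gamma ((n : ℝ) / 2)

/-- The Caffarelli–Savin–Valdinoci constant
`Z(n,s,p) = inf { |E|^{sp/n} ∫_{ℝⁿ∖E} |x−y|^{−n−sp} dy : E measurable, 0 < |E| < ∞, x ∈ E }`. -/
noncomputable def Zconst (n : ℕ) (s p : ℝ) : ℝ≥0∞ :=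
  sInf {z : ℝ≥0∞ | ∃ (E : Set (EuclideanSpace ℝ (Fin n))) (x : EuclideanSpace ℝ (Fin n)),
    MeasurableSet E ∧ 0 < volume E ∧ volume E < ⊤ ∧ x ∈ E ∧
    z = volume E ^ (s * p / (n : ℝ)) *
      ∫⁻ y in Eᶜ, ENNReal.ofReal (‖x - y‖ ^ (-((n : ℝ) + s * p)))}

/-- The bathtub principle: if `f ≥ c` on `B \ E` and `f ≤ c` on `E \ B`, where `E` and `B` have the
same finite measure, then the integral of `f` over `Bᶜ` is at most its integral over `Eᶜ`. -/
theorem setLIntegral_compl_le_of_measure_eq {α : Type*} [MeasurableSpace α] {μ : Measure α}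
    {E B : Set α} (hE : MeasurableSet E) (hB : MeasurableSet B) (hEB : μ E = μ B)
    (hfin : μ E ≠ ⊤) {f : α → ℝ≥0∞} {c : ℝ≥0∞} (hge : ∀ y ∈ B \ E, c ≤ f y)
    (hle : ∀ y ∈ E \ B, f y ≤ c) :
    ∫⁻ y in Bᶜ, f y ∂μ ≤ ∫⁻ y in Eᶜ, f y ∂μ := by
  have hmeas : μ (E \ B) = μ (B \ E) :=
    measure_sdiff_symm hE.nullMeasurableSet hB.nullMeasurableSet hEB
      (measure_ne_top_of_subset inter_subset_left hfin)
  have hmid : ∫⁻ y in E \ B, f y ∂μ ≤ ∫⁻ y in B \ E, f y ∂μ :=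
    calc
      ∫⁻ y in E \ B, f y ∂μ ≤ ∫⁻ _ in E \ B, c ∂μ := setLIntegral_mono' (hE.diff hB) hle
      _ = ∫⁻ _ in B \ E, c ∂μ := by simp [hmeas]
      _ ≤ ∫⁻ y in B \ E, f y ∂μ := setLIntegral_mono' (hB.diff hE) hge
  rw [← lintegral_inter_add_sdiff f Bᶜ hE, ← lintegral_inter_add_sdiff f Eᶜ hB,
    inter_comm Bᶜ E, inter_comm Eᶜ B, ← sdiff_eq, ← sdiff_eq,
    show Bᶜ \ E = Eᶜ \ B by rw [sdiff_eq, sdiff_eq, inter_comm]]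
  gcongr

/-- The integral of `‖y‖ ^ (-(d + a))`, `d` the dimension, over the complement of a ball. -/
theorem lintegral_compl_closedBall_norm_rpow {F : Type*} [NormedAddCommGroup F] [NormedSpace ℝ F]
    [Nontrivial F] [FiniteDimensional ℝ F] [MeasurableSpace F] [BorelSpace F] (μ : Measure F)
    [μ.IsAddHaarMeasure] {a r : ℝ} (ha : 0 < a) (hr : 0 < r) :
    ∫⁻ y in (Metric.closedBall (0 : F) r)ᶜ,
        ENNReal.ofReal (‖y‖ ^ (-((Module.finrank ℝ F : ℝ) + a))) ∂μ =
      ENNReal.ofReal (Module.finrank ℝ F * μ.real (Metric.ball 0 1) * (r ^ (-a) / a)) := by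
  set d := Module.finrank ℝ F with hd
  have hd1 : 1 ≤ d := Module.finrank_pos
  set g : ℝ → ℝ := (Ioi r).indicator fun t ↦ t ^ (-((d : ℝ) + a)) with hg
  have hg0 : ∀ t, 0 ≤ g t := fun t ↦
    indicator_nonneg (fun u (hu : r < u) ↦ Real.rpow_nonneg (hr.trans hu).le _) t
  have hweight : (fun t : ℝ ↦ t ^ (d - 1) • g t) = (Ioi r).indicator fun t ↦ t ^ (-a - 1) := by
    ext t
    by_cases ht : r < t
    · have ht0 : 0 < t := hr.trans ht
      simp only [hg, indicator_of_mem (mem_Ioi.2 ht), smul_eq_mul]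
      rw [← Real.rpow_natCast, ← Real.rpow_add ht0, Nat.cast_sub hd1]
      congr 1
      push_cast
      ring
    · simp [hg, ht]
  have hsub : Ioi r ∩ Ioi (0 : ℝ) = Ioi r := inter_eq_left.2 (Ioi_subset_Ioi hr.le)
  have hint : Integrable (fun y : F ↦ g ‖y‖) μ := by
    rw [integrable_fun_norm_addHaar μ, hweight, IntegrableOn,
      integrable_indicator_iff measurableSet_Ioi, IntegrableOn,
      Measure.restrict_restrict measurableSet_Ioi, hsub]
    exact integrableOn_Ioi_rpow_of_lt (by linarith) hr
  have hval : ∫ y, g ‖y‖ ∂μ = d * μ.real (Metric.ball 0 1) * (r ^ (-a) / a) := by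
    rw [integral_fun_norm_addHaar μ, hweight, integral_indicator measurableSet_Ioi,
      Measure.restrict_restrict measurableSet_Ioi, hsub,
      integral_Ioi_rpow_of_lt (by linarith) hr, sub_add_cancel, neg_div_neg_eq, nsmul_eq_mul,
      smul_eq_mul, mul_assoc]
  rw [← hval, ofReal_integral_eq_lintegral_ofReal hint (.of_forall fun y ↦ hg0 _),
    ← lintegral_indicator Metric.isClosed_closedBall.measurableSet.compl]
  congr 1 with y
  by_cases hy : r < ‖y‖ <;> simp [hg, indicator, hy]

theorem omegaN_pos {n : ℕ} (hn : 0 < n) : 0 < omegaN n := by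
  have : 0 < Real.Gamma ((n : ℝ) / 2) := Real.Gamma_pos_of_pos (by positivity)
  unfold omegaN
  positivity

/-- The volume of a ball of radius `r` in `ℝⁿ` is `rⁿ ω_n / n`. -/
theorem volume_closedBall_eq_omegaN {n : ℕ} (hn : 0 < n) (x : EuclideanSpace ℝ (Fin n)) {r : ℝ}
    (hr : 0 ≤ r) :
    volume (Metric.closedBall x r) = ENNReal.ofReal (r ^ n * (omegaN n / n)) := by
  have : Nonempty (Fin n) := ⟨⟨0, hn⟩⟩
  have hn' : (0 : ℝ) < n := by exact_mod_cast hn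
  have hG : Real.Gamma ((n : ℝ) / 2) ≠ 0 := (Real.Gamma_pos_of_pos (by positivity)).ne'
  rw [EuclideanSpace.volume_closedBall, Fintype.card_fin, ← ENNReal.ofReal_pow hr,
    ← ENNReal.ofReal_mul (by positivity), Real.Gamma_add_one (by positivity), omegaN,
    Real.sqrt_eq_rpow, ← Real.rpow_natCast (_ ^ _), ← Real.rpow_mul Real.pi_pos.le,
    one_div_mul_eq_div]
  congr 2
  field_simp

/-- Among all sets of a given finite volume containing `x`, the integral of `‖x - y‖ ^ (-(n + a))`
over the complement is at least its value for the ball centred at `x`. -/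
theorem le_setLIntegral_compl_norm_sub_rpow {n : ℕ} (hn : 0 < n) {a : ℝ} (ha : 0 < a)
    {E : Set (EuclideanSpace ℝ (Fin n))} {x : EuclideanSpace ℝ (Fin n)} (hE : MeasurableSet E)
    (hpos : 0 < volume E) (hfin : volume E < ⊤) (hx : x ∈ E) :
    ENNReal.ofReal (a⁻¹ * omegaN n ^ (1 + a / (n : ℝ)) * (n : ℝ) ^ (-(a / (n : ℝ))) *
        (volume E).toReal ^ (-(a / (n : ℝ)))) ≤
      ∫⁻ y in Eᶜ, ENNReal.ofReal (‖x - y‖ ^ (-((n : ℝ) + a))) := by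
  have : Nonempty (Fin n) := ⟨⟨0, hn⟩⟩
  have hn' : (0 : ℝ) < n := by exact_mod_cast hn
  have hω := omegaN_pos hn
  have hV : 0 < (volume E).toReal := ENNReal.toReal_pos hpos.ne' hfin.ne
  set V := (volume E).toReal with hVdef
  set r : ℝ := (n * V / omegaN n) ^ ((n : ℝ)⁻¹) with hrdef
  have hr : 0 < r := by positivity
  have hrn : r ^ n = n * V / omegaN n := Real.rpow_inv_natCast_pow (by positivity) hn.ne'
  have hvol : volume E = volume (Metric.closedBall x r) := by
    rw [volume_closedBall_eq_omegaN hn x hr.le, hrn, ← ENNReal.ofReal_toReal hfin.ne]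
    congr 1
    rw [← hVdef]
    field_simp
  have hball : volume.real (Metric.ball (0 : EuclideanSpace ℝ (Fin n)) 1) = omegaN n / n := by
    rw [Measure.real, ← Measure.addHaar_closedBall_eq_addHaar_ball,
      volume_closedBall_eq_omegaN hn 0 zero_le_one, one_pow, one_mul,
      ENNReal.toReal_ofReal (by positivity)]
  have hshift : ∫⁻ y in (Metric.closedBall x r)ᶜ, ENNReal.ofReal (‖x - y‖ ^ (-((n : ℝ) + a))) =
      ∫⁻ y in (Metric.closedBall (0 : EuclideanSpace ℝ (Fin n)) r)ᶜ,
        ENNReal.ofReal (‖y‖ ^ (-((n : ℝ) + a))) := by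
    rw [← lintegral_indicator Metric.isClosed_closedBall.measurableSet.compl,
      ← lintegral_indicator Metric.isClosed_closedBall.measurableSet.compl,
      ← lintegral_sub_left_eq_self _ x]
    congr 1 with y
    simp [indicator, dist_eq_norm]
  have hvalue := lintegral_compl_closedBall_norm_rpow
    (volume : Measure (EuclideanSpace ℝ (Fin n))) ha hr
  rw [finrank_euclideanSpace_fin, hball] at hvalue
  have hconst : a⁻¹ * omegaN n ^ (1 + a / (n : ℝ)) * (n : ℝ) ^ (-(a / (n : ℝ))) *
      V ^ (-(a / (n : ℝ))) = n * (omegaN n / n) * (r ^ (-a) / a) := by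
    rw [hrdef, ← Real.rpow_mul (by positivity), show (n : ℝ)⁻¹ * -a = -(a / n) by ring,
      Real.div_rpow (by positivity) hω.le, Real.mul_rpow hn'.le hV.le, Real.rpow_add hω,
      Real.rpow_one, Real.rpow_neg hω.le, div_inv_eq_mul]
    field_simp
  rw [hconst, ← hvalue, ← hshift]
  refine setLIntegral_compl_le_of_measure_eq hE Metric.isClosed_closedBall.measurableSet hvol
    hfin.ne (c := ENNReal.ofReal (r ^ (-((n : ℝ) + a)))) ?_ ?_
  · rintro y ⟨hy, hyE⟩
    have hxy : 0 < ‖x - y‖ := norm_pos_iff.2 (sub_ne_zero.2 fun h ↦ hyE (h ▸ hx))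
    rw [Metric.mem_closedBall', dist_eq_norm] at hy
    exact ENNReal.ofReal_le_ofReal
      (Real.rpow_le_rpow_of_nonpos hxy hy (by linarith))
  · rintro y ⟨-, hy⟩
    rw [Metric.mem_closedBall', dist_eq_norm, not_le] at hy
    exact ENNReal.ofReal_le_ofReal
      (Real.rpow_le_rpow_of_nonpos hr hy.le (by linarith))

/-- for every measurable `E ⊂ ℝⁿ` with `0 < |E| < ∞` and every `x ∈ E`,
`∫_{ℝⁿ∖E} |x−y|^{−n−sp} dy ≥ (sp)⁻¹ ω_n^{1+sp/n} n^{−1−sp/n} |E|^{−sp/n}`; consequently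
`Z(n,s,p) ≥ (sp)⁻¹ ω_n^{1+sp/n} n^{−1−sp/n}`. -/
theorem Zconst_lower_bound (n : ℕ) (hn : 0 < n) (s p : ℝ)
    (hs : s ∈ Set.Ioo (0 : ℝ) 1) (hp : 1 ≤ p) :
    (∀ (E : Set (EuclideanSpace ℝ (Fin n))) (x : EuclideanSpace ℝ (Fin n)),
      MeasurableSet E → 0 < volume E → volume E < ⊤ → x ∈ E →
      ENNReal.ofReal ((s * p)⁻¹ * omegaN n ^ (1 + s * p / (n : ℝ)) *
          (n : ℝ) ^ (-(1 + s * p / (n : ℝ))) * (volume E).toReal ^ (-(s * p / (n : ℝ)))) ≤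
        ∫⁻ y in Eᶜ, ENNReal.ofReal (‖x - y‖ ^ (-((n : ℝ) + s * p)))) ∧
    ENNReal.ofReal ((s * p)⁻¹ * omegaN n ^ (1 + s * p / (n : ℝ)) *
        (n : ℝ) ^ (-(1 + s * p / (n : ℝ)))) ≤ Zconst n s p := by
  have ha : 0 < s * p := mul_pos hs.1 (by linarith)
  have hn1 : (1 : ℝ) ≤ n := by exact_mod_cast hn
  have hω := omegaN_pos hn
  have hbound : ∀ (E : Set (EuclideanSpace ℝ (Fin n))) (x : EuclideanSpace ℝ (Fin n)),
      MeasurableSet E → 0 < volume E → volume E < ⊤ → x ∈ E →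
      ENNReal.ofReal ((s * p)⁻¹ * omegaN n ^ (1 + s * p / (n : ℝ)) *
          (n : ℝ) ^ (-(1 + s * p / (n : ℝ))) * (volume E).toReal ^ (-(s * p / (n : ℝ)))) ≤
        ∫⁻ y in Eᶜ, ENNReal.ofReal (‖x - y‖ ^ (-((n : ℝ) + s * p))) := by
    intro E x hE hpos hfin hx
    refine le_trans (ENNReal.ofReal_le_ofReal ?_)
      (le_setLIntegral_compl_norm_sub_rpow hn ha hE hpos hfin hx)
    gcongr
    linarith
  refine ⟨hbound, le_sInf ?_⟩
  rintro z ⟨E, x, hE, hpos, hfin, hx, rfl⟩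
  have hV : 0 < (volume E).toReal := ENNReal.toReal_pos hpos.ne' hfin.ne
  refine le_trans (le_of_eq ?_) (mul_le_mul_right (hbound E x hE hpos hfin hx) _)
  conv_rhs => rw [← ENNReal.ofReal_toReal hfin.ne]
  rw [ENNReal.ofReal_rpow_of_pos hV, ENNReal.toReal_ofReal hV.le,
    ← ENNReal.ofReal_mul (by positivity), Real.rpow_neg hV.le]
  congr 1
  field_simp
end
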